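/- For every element a of the valuation ring O_𝔭 of the 𝔭-adic completion K_𝔭, and for every integer n ≥ 1, there exists a nonzero totally positive element k of O_K with v_𝔭(k − a) ≥ n, i.e. k ≡ a mod 𝔭^n O_𝔭. -/

import Mathlib

open IsDedekindDomain IsDedekindDomain.HeightOneSpectrum NumberField
open scoped Multiplicative nonZeroDivisors

/-- `x : K` is totally positive if every real embedding sends it to a positive real. -/
def IsTotPos (K : Type) [Field K] [NumberField K] (x : K) : Prop := ∀ φ : K →+* ℝ, 0 < φ x

/-- The image of a Dedekind domain is dense in the valuation ring of its `v`-adic completion. -/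
theorem exists_valued_algebraMap_sub_le_exp {R K : Type*} [CommRing R] [IsDedekindDomain R]
    [Field K] [Algebra R K] [IsFractionRing R K] (v : HeightOneSpectrum R)
    (a : v.adicCompletionIntegers K) (n : ℕ) :
    ∃ r : R, Valued.v (algebraMap K (v.adicCompletion K) (algebraMap R K r)
      - (a : v.adicCompletion K)) ≤ WithZero.exp (-(n : ℤ)) := by
  have hv (x : K) : Valued.v (algebraMap K (v.adicCompletion K) x) = v.valuation K x :=
    valuedAdicCompletion_eq_valuation' v x
  obtain ⟨π, hπ⟩ := v.valuation_exists_uniformizer K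
  have hπn : Valued.v (algebraMap K (v.adicCompletion K) (π ^ n)) =
      WithZero.exp (-(n : ℤ)) := by
    rw [hv, map_pow, hπ, ← WithZero.exp_nsmul]
    simp
  set c := algebraMap K (v.adicCompletion K) (π ^ n)
  have hc : Valued.v.restrict c ≠ 0 := by
    rw [(Valuation.restrict _).ne_zero_iff, ← (Valued.v (R := v.adicCompletion K)).ne_zero_iff,
      hπn]
    exact WithZero.exp_ne_zero
  have hmem : {y : v.adicCompletion K | Valued.v (y - a) < Valued.v c} ∈
      nhds (a : v.adicCompletion K) :=
    Valued.mem_nhds.mpr ⟨Units.mk0 _ hc, fun y hy ↦ (Valued.v.restrict_lt_iff).mp hy⟩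
  obtain ⟨_, hx, x, rfl⟩ := mem_closure_iff_nhds.mp (v.denseRange_algebraMap K a) _ hmem
  rw [Set.mem_ofPred_eq, hπn] at hx
  have hx1 : v.valuation K x ≤ 1 := by
    rw [← hv, ← sub_add_cancel (algebraMap K (v.adicCompletion K) x) a]
    refine (Valued.v.map_add _ _).trans (max_le (hx.le.trans ?_) a.2)
    rw [← WithZero.exp_zero, WithZero.exp_le_exp]
    lia
  obtain ⟨r, hr⟩ := v.exists_valuation_sub_lt_of_integer hx1
    (Units.mk0 (WithZero.exp (-(n : ℤ))) WithZero.exp_ne_zero)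
  refine ⟨r, ?_⟩
  rw [← sub_add_sub_cancel _ (algebraMap K (v.adicCompletion K) x), ← map_sub]
  exact (Valued.v.map_add _ _).trans (max_le (by rw [hv]; exact hr.le) hx.le)

/-- Adding a large multiple of a positive integer makes an algebraic integer nonzero and totally
positive. -/
theorem exists_add_natCast_mul_isTotPos (K : Type) [Field K] [NumberField K] (r : 𝓞 K) {N : ℕ}
    (hN : N ≠ 0) : ∃ m : ℕ, r + m * N ≠ 0 ∧ IsTotPos K (algebraMap (𝓞 K) K (r + m * N)) := by
  have hinj : Function.Injective fun m : ℕ ↦ r + m * (N : 𝓞 K) := fun m m' h ↦ by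
    simpa [hN] using h
  have hne : ∀ᶠ m : ℕ in Filter.atTop, r + m * (N : 𝓞 K) ≠ 0 := by
    rw [← Nat.cofinite_eq_atTop]
    exact hinj.tendsto_cofinite.eventually (Filter.eventually_cofinite_ne 0)
  have hpos : ∀ᶠ m : ℕ in Filter.atTop, ∀ φ : K →+* ℝ,
      0 < φ (algebraMap (𝓞 K) K (r + m * N)) := by
    refine Filter.eventually_all.mpr fun φ ↦ ?_
    have hlim : Filter.Tendsto (fun m : ℕ ↦ φ (algebraMap (𝓞 K) K r) + m * (N : ℝ))
        Filter.atTop Filter.atTop :=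
      Filter.tendsto_atTop_add_const_left _ _
        (tendsto_natCast_atTop_atTop.atTop_mul_const (by positivity))
    filter_upwards [hlim.eventually_gt_atTop 0] with m hm
    simpa only [map_add, map_mul, map_natCast] using hm
  exact (hne.and hpos).exists

/-- STATEMENT 11: every element of the valuation ring `O_𝔭` of the completion `K_𝔭` can be
approximated modulo `𝔭^n O_𝔭` (for any `n ≥ 1`) by a nonzero totally positive element of the
ring of integers `O_K`. -/
theorem statement11 (K : Type) [Field K] [NumberField K] (𝔭 : HeightOneSpectrum (𝓞 K))
    (a : 𝔭.adicCompletionIntegers K) (n : ℕ) (hn : 1 ≤ n) :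
    ∃ k : 𝓞 K, k ≠ 0 ∧ IsTotPos K (algebraMap (𝓞 K) K k) ∧
      Valued.v (algebraMap K (𝔭.adicCompletion K) (algebraMap (𝓞 K) K k)
          - (a : 𝔭.adicCompletion K)) ≤
        WithZero.coe (Multiplicative.ofAdd (-(n : ℤ))) := by
  obtain ⟨r, hr⟩ := exists_valued_algebraMap_sub_le_exp 𝔭 a n
  set N := Ideal.absNorm (𝔭.asIdeal ^ n)
  have hN : N ≠ 0 := by
    rw [Ne, Ideal.absNorm_eq_zero_iff]
    exact pow_ne_zero n 𝔭.ne_bot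
  obtain ⟨m, hm0, hmpos⟩ := exists_add_natCast_mul_isTotPos K r hN
  refine ⟨r + m * N, hm0, hmpos, ?_⟩
  rw [map_add, map_add, add_sub_right_comm]
  refine (Valued.v.map_add _ _).trans (max_le hr ?_)
  refine (valuedAdicCompletion_eq_valuation' 𝔭 _).trans_le ?_
  rw [Algebra.algebraMap_self_apply, valuation_of_algebraMap]
  exact (𝔭.intValuation_le_pow_iff_mem _ n).mpr
    (Ideal.mul_mem_left _ _ (Ideal.absNorm_mem _))
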